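/- arXiv:1908.08882 — 3 statements merged into one kernel-verified Lean document; each statement's English description precedes it below -/
import Mathlib

section
/- Let τ be a left-closed linear order on V(𝒢) extending the partial order α induced by a simultaneous enumeration ζ of a sunflower graph 𝒢 = (G_1,…,G_k). Define the graph H = (V, E') with E' = {ux : there exist v,w with (v,w) ∈ E and v ≤_τ u <_τ x ≤_τ w}. Then τ is a fine enumeration of H, E ⊆ E' (as unordered pairs), and no pair from F is an edge of E' (so H contains each G_i as an induced subgraph). -/
/-!
Common definitions: graphs on a vertex subset, (proper/unit) interval
representations, blocks, straight enumerations, sunflower graphs,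
simultaneous enumerations, components, chains/bars, etc.
-/

universe u

/-- A finite simple graph on a subset `verts` of an ambient vertex type `V`. -/
structure GraphOn (V : Type u) where
  verts : Set V
  Adj : V → V → Prop
  symm : ∀ {u v}, Adj u v → Adj v u
  loopless : ∀ v, ¬ Adj v v
  mem_of_adj : ∀ {u v}, Adj u v → u ∈ verts ∧ v ∈ verts

namespace GraphOn

variable {V : Type u}

/-- The closed real interval assigned to vertex `v` by the endpoint map `I`. -/
def ivl (I : V → ℝ × ℝ) (v : V) : Set ℝ := Set.Icc (I v).1 (I v).2

/-- `I` is an interval representation of `G`: each vertex gets a (nonempty) closed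
interval and intervals of distinct vertices intersect iff the vertices are adjacent. -/
def IsRep (G : GraphOn V) (I : V → ℝ × ℝ) : Prop :=
  (∀ v ∈ G.verts, (I v).1 ≤ (I v).2) ∧
    ∀ u ∈ G.verts, ∀ v ∈ G.verts, u ≠ v → ((ivl I u ∩ ivl I v).Nonempty ↔ G.Adj u v)

/-- A proper interval representation: no interval properly contains another. -/
def IsProperRep (G : GraphOn V) (I : V → ℝ × ℝ) : Prop :=
  G.IsRep I ∧ ∀ u ∈ G.verts, ∀ v ∈ G.verts, u ≠ v → ¬ ivl I v ⊂ ivl I u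

/-- A unit interval representation: all intervals have length one. -/
def IsUnitRep (G : GraphOn V) (I : V → ℝ × ℝ) : Prop :=
  G.IsRep I ∧ ∀ v ∈ G.verts, (I v).2 = (I v).1 + 1

/-- Two vertices are in the same block iff they have equal closed neighborhoods. -/
def SameBlock (G : GraphOn V) (u v : V) : Prop :=
  u ∈ G.verts ∧ v ∈ G.verts ∧ ∀ w, (G.Adj u w ∨ u = w) ↔ (G.Adj v w ∨ v = w)

/-- Block-level closed adjacency: adjacent or in the same block. -/
def CAdj (G : GraphOn V) (u v : V) : Prop := G.Adj u v ∨ G.SameBlock u v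

/-- `u` and `v` lie in the same connected component of `G` (and in `G`). -/
def Reach (G : GraphOn V) (u v : V) : Prop :=
  u ∈ G.verts ∧ v ∈ G.verts ∧ Relation.ReflTransGen G.Adj u v

/-- The subgraph of `G` induced on the vertices of `G` lying in `C`. -/
def restrict (G : GraphOn V) (C : Set V) : GraphOn V where
  verts := G.verts ∩ C
  Adj u v := G.Adj u v ∧ u ∈ C ∧ v ∈ C
  symm h := ⟨G.symm h.1, h.2.2, h.2.1⟩
  loopless v h := G.loopless v h.1
  mem_of_adj h := ⟨⟨(G.mem_of_adj h.1).1, h.2.1⟩, (G.mem_of_adj h.1).2, h.2.2⟩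

end GraphOn

open GraphOn

variable {V : Type u}

/-- The union graph `G_1 ∪ … ∪ G_k`. -/
def unionGraph {k : ℕ} (G : Fin k → GraphOn V) : GraphOn V where
  verts := ⋃ i, (G i).verts
  Adj u v := ∃ i, (G i).Adj u v
  symm h := h.elim fun i hi => ⟨i, (G i).symm hi⟩
  loopless v h := h.elim fun i hi => (G i).loopless v hi
  mem_of_adj h := h.elim fun i hi =>
    ⟨Set.mem_iUnion.2 ⟨i, ((G i).mem_of_adj hi).1⟩,
     Set.mem_iUnion.2 ⟨i, ((G i).mem_of_adj hi).2⟩⟩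

/-- A straight enumeration of `G`, encoded at the vertex level: `le u v` means the
block of `u` comes at or before the block of `v`.  It is a total preorder on the
vertices whose equivalence classes are exactly the blocks, and such that every block
together with its adjacent blocks is consecutive. -/
structure StraightEnum {V : Type u} (G : GraphOn V) where
  le : V → V → Prop
  refl : ∀ v ∈ G.verts, le v v
  trans : ∀ u ∈ G.verts, ∀ v ∈ G.verts, ∀ w ∈ G.verts, le u v → le v w → le u w
  total : ∀ u ∈ G.verts, ∀ v ∈ G.verts, le u v ∨ le v u
  eq_block : ∀ u ∈ G.verts, ∀ v ∈ G.verts, (le u v ∧ le v u ↔ G.SameBlock u v)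
  straight : ∀ u ∈ G.verts, ∀ v ∈ G.verts, ∀ w ∈ G.verts,
    le u v → le v w → G.CAdj u w → G.CAdj u v ∧ G.CAdj v w

/-- `B(u,G) <_σ B(v,G)`: the block of `u` comes strictly before the block of `v`. -/
def StraightEnum.lt {V : Type u} {G : GraphOn V} (σ : StraightEnum G) (u v : V) : Prop :=
  σ.le u v ∧ ¬ σ.le v u

/-- `le` is a linear order on the set `s`. -/
def IsLinOrdOn (s : Set V) (le : V → V → Prop) : Prop :=
  (∀ v ∈ s, le v v) ∧ (∀ u ∈ s, ∀ v ∈ s, ∀ w ∈ s, le u v → le v w → le u w) ∧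
    (∀ u ∈ s, ∀ v ∈ s, le u v → le v u → u = v) ∧ (∀ u ∈ s, ∀ v ∈ s, le u v ∨ le v u)

/-- `le` is a partial order on the set `s`. -/
def IsPartialOrderOn (s : Set V) (le : V → V → Prop) : Prop :=
  (∀ v ∈ s, le v v) ∧ (∀ u ∈ s, ∀ v ∈ s, ∀ w ∈ s, le u v → le v w → le u w) ∧
    (∀ u ∈ s, ∀ v ∈ s, le u v → le v u → u = v)

/-- `S` is an induced subgraph of `G`. -/
def IsInduced (S G : GraphOn V) : Prop :=
  S.verts ⊆ G.verts ∧ ∀ u ∈ S.verts, ∀ v ∈ S.verts, (S.Adj u v ↔ G.Adj u v)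

/-- `(G_1,…,G_k)` is a sunflower graph with shared graph `S`: any two distinct
graphs share exactly `S` (vertices and edges), and `S` is induced in each `G_i`. -/
def IsSunflower {k : ℕ} (G : Fin k → GraphOn V) (S : GraphOn V) : Prop :=
  (∀ i, IsInduced S (G i)) ∧
    ∀ i j, i ≠ j → (G i).verts ∩ (G j).verts = S.verts ∧
      ∀ u v, (G i).Adj u v → (G j).Adj u v → S.Adj u v

/-- `𝒢` admits a simultaneous interval representation. -/
def HasSimRep {k : ℕ} (G : Fin k → GraphOn V) : Prop :=
  ∃ I : V → ℝ × ℝ, ∀ i, (G i).IsRep I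

/-- `𝒢` admits a simultaneous proper interval representation. -/
def HasSimProperRep {k : ℕ} (G : Fin k → GraphOn V) : Prop :=
  ∃ I : V → ℝ × ℝ, ∀ i, (G i).IsProperRep I

/-- `𝒢` admits a simultaneous unit interval representation. -/
def HasSimUnitRep {k : ℕ} (G : Fin k → GraphOn V) : Prop :=
  ∃ I : V → ℝ × ℝ, ∀ i, (G i).IsUnitRep I

/-- The representation `I` of `G` corresponds to (realizes) the straight enumeration `σ`:
ordering the intervals by left endpoints and grouping blocks yields `σ`. -/
def Realizes (G : GraphOn V) (I : V → ℝ × ℝ) (σ : StraightEnum G) : Prop :=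
  ∀ u ∈ G.verts, ∀ v ∈ G.verts, σ.lt u v → (I u).1 < (I v).1

/-- Simultaneous enumeration: blocks containing shared vertices are never ordered
oppositely in two of the straight enumerations. -/
def IsSimEnum {k : ℕ} (G : Fin k → GraphOn V) (S : GraphOn V)
    (σ : ∀ i, StraightEnum (G i)) : Prop :=
  ∀ i j, ∀ u ∈ S.verts, ∀ v ∈ S.verts, (σ i).lt u v → (σ j).le u v

/-- A straight enumeration `σ` of `G` is compatible with a linear order `ζ` of the
shared vertex set `VS`: `u ≤_ζ v` implies `B(u,G) ≤_σ B(v,G)`. -/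
def Compatible (G : GraphOn V) (σ : StraightEnum G) (VS : Set V) (ζ : V → V → Prop) : Prop :=
  ∀ u ∈ VS, ∀ v ∈ VS, ζ u v → σ.le u v

/-- The component of `c` in `G` is loose: all its shared vertices lie in one block of `S`. -/
def LooseAt (G S : GraphOn V) (c : V) : Prop :=
  c ∈ G.verts ∧ ∀ u v, G.Reach c u → G.Reach c v → u ∈ S.verts → v ∈ S.verts → S.SameBlock u v

/-- The component of `c` in `G` is oriented at the block of `b` in `S`: it aligns two
vertices of that block (they lie in different blocks of the component). -/
def OrientedAt (G S : GraphOn V) (c b : V) : Prop :=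
  c ∈ G.verts ∧ b ∈ S.verts ∧ ∃ u v, G.Reach c u ∧ G.Reach c v ∧
    S.SameBlock b u ∧ S.SameBlock b v ∧ ¬ G.SameBlock u v

/-- The component of `c` in `G` is independent: it aligns no two shared vertices. -/
def IndependentAt (G S : GraphOn V) (c : V) : Prop :=
  c ∈ G.verts ∧ ∀ u v, G.Reach c u → G.Reach c v → u ∈ S.verts → v ∈ S.verts → G.SameBlock u v

/-- `le'` is obtained from `le` by reversing exactly the components marked by `flip`
(componentwise-constant), keeping the order of the components themselves. -/
def ObtainedByFlip (G : GraphOn V) (flip : V → Prop) (le le' : V → V → Prop) : Prop :=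
  (∀ u v, G.Reach u v → (flip u ↔ flip v)) ∧
    ∀ u ∈ G.verts, ∀ v ∈ G.verts,
      (G.Reach u v → ((flip u → (le' u v ↔ le v u)) ∧ (¬ flip u → (le' u v ↔ le u v)))) ∧
      (¬ G.Reach u v → (le' u v ↔ le u v))

/-- `le'` is obtained from `le` through reversal of loose components. -/
def ObtainedByLooseReversals (G S : GraphOn V) (le le' : V → V → Prop) : Prop :=
  ∃ flip : V → Prop, (∀ c ∈ G.verts, flip c → LooseAt G S c) ∧
    ObtainedByFlip G flip le le'

/-- A family of flips (one per graph) corresponding to reversals of independent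
components and of reversible parts: only loose components are flipped, and all
components oriented at a common block of `S` are flipped consistently and, if
flipped, are all loose. -/
def ValidFlips {k : ℕ} (G : Fin k → GraphOn V) (S : GraphOn V)
    (flip : Fin k → V → Prop) : Prop :=
  (∀ i, ∀ c ∈ (G i).verts, flip i c → LooseAt (G i) S c) ∧
    ∀ b ∈ S.verts, ∀ i j c c', OrientedAt (G i) S c b → OrientedAt (G j) S c' b →
      (flip i c ↔ flip j c') ∧ (flip i c → LooseAt (G j) S c')

/-- `le` is a fine enumeration of the graph with vertex set `verts` and adjacency
`Adj`: a linear order on `verts` in which every closed neighborhood is consecutive. -/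
def FineEnumOn (verts : Set V) (Adj : V → V → Prop) (le : V → V → Prop) : Prop :=
  IsLinOrdOn verts le ∧
    ∀ u ∈ verts, ∀ a ∈ verts, ∀ b ∈ verts, ∀ c ∈ verts,
      le a b → le b c → (Adj u a ∨ u = a) → (Adj u c ∨ u = c) → (Adj u b ∨ u = b)

/-- A `(u,v)`-chain of size `l` in `(G,σ)`: a `σ`-increasing sequence from `u` to `v`
forming a path in `G`. -/
def IsChainSeq (G : GraphOn V) (σ : StraightEnum G) (u v : V) (l : ℕ) : Prop :=
  ∃ c : ℕ → V, c 0 = u ∧ c (l - 1) = v ∧ (∀ t < l, c t ∈ G.verts) ∧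
    (∀ s t, s < t → t < l → σ.lt (c s) (c t)) ∧
    (∀ t, t + 1 < l → G.Adj (c t) (c (t + 1)))

/-- A `(u,v)`-bar of size `l` in `(G,σ)`: a `σ`-increasing sequence from `u` to `v`
forming an independent set in `G`. -/
def IsBarSeq (G : GraphOn V) (σ : StraightEnum G) (u v : V) (l : ℕ) : Prop :=
  ∃ b : ℕ → V, b 0 = u ∧ b (l - 1) = v ∧ (∀ t < l, b t ∈ G.verts) ∧
    (∀ s t, s < t → t < l → σ.lt (b s) (b t)) ∧
    (∀ s t, s < l → t < l → s ≠ t → ¬ G.Adj (b s) (b t))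

/-- `𝒢` has a (chain-bar-)conflict for the simultaneous enumeration `σ`. -/
def HasConflict {k : ℕ} (G : Fin k → GraphOn V) (S : GraphOn V)
    (σ : ∀ i, StraightEnum (G i)) : Prop :=
  ∃ u ∈ S.verts, ∃ v ∈ S.verts, u ≠ v ∧ ∃ i j l, 2 ≤ l ∧
    IsChainSeq (G i) (σ i) u v l ∧ ∃ m, l ≤ m ∧ IsBarSeq (G j) (σ j) u v m

/-- The union of the block orders of the single enumerations. -/
def alphaStar {k : ℕ} (G : Fin k → GraphOn V) (σ : ∀ i, StraightEnum (G i))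
    (u v : V) : Prop :=
  ∃ i, u ∈ (G i).verts ∧ v ∈ (G i).verts ∧ (σ i).le u v

/-- The partial order `α` on `V(𝒢)` induced by the simultaneous enumeration:
the transitive closure of the union of the single block orders. -/
def alphaOrd {k : ℕ} (G : Fin k → GraphOn V) (σ : ∀ i, StraightEnum (G i)) :
    V → V → Prop :=
  Relation.TransGen (alphaStar G σ)

/-- The `α`-ordered pairs that are edges of some `G_i`. -/
def ERel {k : ℕ} (G : Fin k → GraphOn V) (σ : ∀ i, StraightEnum (G i))
    (u v : V) : Prop :=
  alphaOrd G σ u v ∧ ∃ i, (G i).Adj u v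

/-- The `α`-ordered pairs that are non-edges of some `G_i` (both endpoints in `G_i`). -/
def FRel {k : ℕ} (G : Fin k → GraphOn V) (σ : ∀ i, StraightEnum (G i))
    (u v : V) : Prop :=
  alphaOrd G σ u v ∧ u ≠ v ∧ ∃ i, u ∈ (G i).verts ∧ v ∈ (G i).verts ∧ ¬ (G i).Adj u v

/-- A partial order `τ` is left-closed: `(v,w) ∈ E`, `(u,x) ∈ F` and `x ≤_τ w`
imply `u <_τ v`. -/
def LeftClosed {k : ℕ} (G : Fin k → GraphOn V) (σ : ∀ i, StraightEnum (G i))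
    (τ : V → V → Prop) : Prop :=
  ∀ v w u x, ERel G σ v w → FRel G σ u x → τ x w → τ u v ∧ u ≠ v

/-- A relaxed `(u,v)`-chain of size `l`: an `α`-increasing sequence from `u` to `v`
forming a path in the union graph `G* = G_1 ∪ … ∪ G_k`. -/
def IsRelaxedChainSeq {k : ℕ} (G : Fin k → GraphOn V) (σ : ∀ i, StraightEnum (G i))
    (u v : V) (l : ℕ) : Prop :=
  ∃ c : ℕ → V, c 0 = u ∧ c (l - 1) = v ∧ (∀ t < l, c t ∈ ⋃ i, (G i).verts) ∧
    (∀ s t, s < t → t < l → alphaOrd G σ (c s) (c t) ∧ c s ≠ c t) ∧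
    (∀ t, t + 1 < l → ∃ i, (G i).Adj (c t) (c (t + 1)))

/-- `𝒢` has a relaxed conflict for the simultaneous enumeration `σ`. -/
def HasRelaxedConflict {k : ℕ} (G : Fin k → GraphOn V) (S : GraphOn V)
    (σ : ∀ i, StraightEnum (G i)) : Prop :=
  ∃ u ∈ S.verts, ∃ v ∈ S.verts, u ≠ v ∧ ∃ j l, 2 ≤ l ∧
    IsRelaxedChainSeq G σ u v l ∧ ∃ m, l ≤ m ∧ IsBarSeq (G j) (σ j) u v m

/-- Given a left-closed linear order `τ` extending the partial order
`α` induced by `ζ`, the graph `H = (V, E')` with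
`E' = {ux : ∃ vw ∈ E, v ≤_τ u <_τ x ≤_τ w}` has `τ` as a fine enumeration, contains
all pairs of `E` as edges and no pair of `F`, and hence contains each `G_i` as an
induced subgraph. -/
theorem explicit_sandwich_graph {V : Type u} [Fintype V] {k : ℕ}
    (G : Fin k → GraphOn V) (S : GraphOn V) (hsun : IsSunflower G S)
    (ζ : ∀ i, StraightEnum (G i)) (hζ : IsSimEnum G S ζ)
    (hdist : ∀ i, ∀ u ∈ (G i).verts, ∀ v ∈ (G i).verts,
      (ζ i).le u v → (ζ i).le v u → u = v)
    (τ : V → V → Prop) (hτlin : IsLinOrdOn (⋃ i, (G i).verts) τ)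
    (hτext : ∀ u v, alphaOrd G ζ u v → τ u v) (hτlc : LeftClosed G ζ τ) :
    ∀ A : V → V → Prop,
      (∀ u x, A u x ↔ (u ≠ x ∧ ∃ v w, ERel G ζ v w ∧
        ((τ v u ∧ τ u x ∧ τ x w) ∨ (τ v x ∧ τ x u ∧ τ u w)))) →
      FineEnumOn (⋃ i, (G i).verts) A τ ∧
      (∀ u v, ERel G ζ u v → A u v) ∧
      (∀ u v, FRel G ζ u v → ¬ A u v) ∧
      (∀ i, ∀ u ∈ (G i).verts, ∀ v ∈ (G i).verts, (A u v ↔ (G i).Adj u v)) := by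
  intro A hA
  have ⟨hrefl, htrans, hanti, htotal⟩ := hτlin
  have mem_union : ∀ {i u}, u ∈ (G i).verts → u ∈ ⋃ i, (G i).verts :=
    fun hu => Set.mem_iUnion.2 ⟨_, hu⟩
  have mem_of_ERel : ∀ {v w}, ERel G ζ v w →
      v ∈ (⋃ i, (G i).verts) ∧ w ∈ ⋃ i, (G i).verts := by
    rintro v w ⟨-, i, hi⟩
    exact ⟨mem_union ((G i).mem_of_adj hi).1, mem_union ((G i).mem_of_adj hi).2⟩
  have mem_of_FRel : ∀ {v w}, FRel G ζ v w →
      v ∈ (⋃ i, (G i).verts) ∧ w ∈ ⋃ i, (G i).verts := by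
    rintro v w ⟨-, -, i, hv, hw, -⟩
    exact ⟨mem_union hv, mem_union hw⟩
  have A_symm : ∀ {u x}, A u x → A x u := by
    intro u x h
    obtain ⟨hne, v, w, hE, h⟩ := (hA u x).1 h
    exact (hA x u).2 ⟨hne.symm, v, w, hE, h.symm⟩
  have exists_ERel : ∀ {u x}, u ∈ (⋃ i, (G i).verts) → x ∈ (⋃ i, (G i).verts) → τ u x →
      A u x → ∃ v w, ERel G ζ v w ∧ τ v u ∧ τ x w := by
    intro u x hu hx hux h
    obtain ⟨hne, v, w, hE, h | h⟩ := (hA u x).1 h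
    · exact ⟨v, w, hE, h.1, h.2.2⟩
    · exact absurd (hanti u hu x hx hux h.2.1) hne
  have A_of_ERel : ∀ u v, ERel G ζ u v → A u v := by
    intro u v h
    obtain ⟨i, hi⟩ := h.2
    have hne : u ≠ v := fun huv => (G i).loopless v (huv ▸ hi)
    obtain ⟨hu, hv⟩ := mem_of_ERel h
    exact (hA u v).2 ⟨hne, u, v, h, .inl ⟨hrefl u hu, hτext _ _ h.1, hrefl v hv⟩⟩
  have not_A_of_FRel : ∀ u v, FRel G ζ u v → ¬ A u v := by
    intro u x hF h
    obtain ⟨hu, hx⟩ := mem_of_FRel hF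
    obtain ⟨v, w, hE, hvu, hxw⟩ := exists_ERel hu hx (hτext _ _ hF.1) h
    obtain ⟨huv, hne⟩ := hτlc v w u x hE hF hxw
    exact hne (hanti u hu v (mem_of_ERel hE).1 huv hvu)
  have A_iff_of_le : ∀ i, ∀ u ∈ (G i).verts, ∀ v ∈ (G i).verts, (ζ i).le u v →
      (A u v ↔ (G i).Adj u v) := by
    intro i u hu v hv huv
    have hα : alphaOrd G ζ u v := .single ⟨i, hu, hv, huv⟩
    refine ⟨fun h => ?_, fun h => A_of_ERel u v ⟨hα, i, h⟩⟩
    by_contra hn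
    exact not_A_of_FRel u v ⟨hα, ((hA u v).1 h).1, i, hu, hv, hn⟩ h
  refine ⟨⟨hτlin, ?_⟩, A_of_ERel, not_A_of_FRel, fun i u hu v hv => ?_⟩
  · intro u hu a ha b hb c hc hab hbc hua huc
    by_cases hne : u = b
    · exact .inr hne
    refine .inl ?_
    rcases htotal u hu b hb with hub | hbu
    · have huc' : A u c := huc.resolve_right fun h => hne (hanti u hu b hb hub (h ▸ hbc))
      obtain ⟨v, w, hE, hvu, hcw⟩ :=
        exists_ERel hu hc (htrans u hu b hb c hc hub hbc) huc'
      exact (hA u b).2 ⟨hne, v, w, hE,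
        .inl ⟨hvu, hub, htrans b hb c hc w (mem_of_ERel hE).2 hbc hcw⟩⟩
    · have hua' : A u a := hua.resolve_right fun h => hne (hanti u hu b hb (h ▸ hab) hbu)
      obtain ⟨v, w, hE, hva, huw⟩ :=
        exists_ERel ha hu (htrans a ha b hb u hu hab hbu) (A_symm hua')
      exact (hA u b).2 ⟨hne, v, w, hE,
        .inr ⟨htrans v (mem_of_ERel hE).1 a ha b hb hva hab, hbu, huw⟩⟩
  · rcases (ζ i).total u hu v hv with huv | hvu
    · exact A_iff_of_le i u hu v hv huv
    · exact ⟨fun h => (G i).symm ((A_iff_of_le i v hv u hu hvu).1 (A_symm h)),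
        fun h => A_symm ((A_iff_of_le i v hv u hu hvu).2 ((G i).symm h))⟩
end

section
/- A finite simple graph admits a unit interval representation (all intervals of length exactly 1) if and only if it admits a proper interval representation (no interval properly contains another). -/
/-- `I` is an interval representation of the finite simple graph `G`: each vertex `v`
gets the closed interval `[ (I v).1, (I v).2 ]` and intervals of distinct vertices
intersect iff the vertices are adjacent. -/
def SimpleGraph.IsIntervalRep {V : Type*} (G : SimpleGraph V) (I : V → ℝ × ℝ) : Prop :=
  (∀ v, (I v).1 ≤ (I v).2) ∧
    ∀ u v : V, u ≠ v →
      ((Set.Icc (I u).1 (I u).2 ∩ Set.Icc (I v).1 (I v).2).Nonempty ↔ G.Adj u v)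

open Finset in
/-- If `R` is monotone on a finite set `S`, then `S` can be embedded in `ℝ` in an order-preserving
way such that translation by `1` has the same cut points as `R`. -/
theorem exists_embedding_real_of_monotoneOn {α : Type*} [LinearOrder α] (R : α → α)
    (S : Finset α) (hR : MonotoneOn R S) :
    ∃ x : α → ℝ, ∀ a ∈ S, ∀ b ∈ S, a < b →
      x a < x b ∧ (b ≤ R a → x b < x a + 1) ∧ (R a < b → x a + 1 < x b) := by
  classical
  induction S using Finset.induction_on_max with
  | empty => exact ⟨fun _ => 0, by simp⟩
  | insert m S hm ih =>
    obtain ⟨x, hx⟩ := ih (hR.mono (by simp))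
    obtain ⟨z, hlo, hhi⟩ := Order.exists_between_finsets
      (lo := S.image x ∪ {a ∈ S | R a < m}.image (x · + 1))
      (hi := {a ∈ S | m ≤ R a}.image (x · + 1)) (by
        simp only [mem_union, mem_image, mem_filter]
        rintro _ (⟨c, hc, rfl⟩ | ⟨c, ⟨hc, hcm⟩, rfl⟩) _ ⟨a, ⟨ha, ham⟩, rfl⟩
        · rcases lt_trichotomy c a with h | rfl | h
          · linarith [(hx c hc a ha h).1]
          · linarith
          · exact (hx a ha c hc h).2.1 ((hm c hc).le.trans ham)
        · have h : c < a := by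
            by_contra! h
            exact (hcm.trans_le ham).not_ge
              (hR (by simp [ha]) (by simp [hc]) h)
          linarith [(hx c hc a ha h).1])
    simp only [mem_union, mem_image, mem_filter] at hlo hhi
    refine ⟨Function.update x m z, fun a ha b hb hab => ?_⟩
    have ham : a ≠ m := by
      rintro rfl
      rcases mem_insert.1 hb with rfl | hb
      · exact hab.false
      · exact hab.not_gt (hm b hb)
    have haS : a ∈ S := (mem_insert.1 ha).resolve_left ham
    rcases mem_insert.1 hb with rfl | hbS
    · simp only [Function.update_self, Function.update_of_ne ham]
      exact ⟨hlo _ (.inl ⟨a, haS, rfl⟩), fun h => hhi _ ⟨a, ⟨haS, h⟩, rfl⟩,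
        fun h => hlo _ (.inr ⟨a, ⟨haS, h⟩, rfl⟩)⟩
    · simp only [Function.update_of_ne ham, Function.update_of_ne (hm b hbS).ne]
      exact hx a haS b hbS hab

/-- In a representation by nonempty intervals none of which properly contains another, the right
endpoints are ordered as the left endpoints. -/
theorem right_le_right_of_not_Icc_ssubset {V : Type*} {I : V → ℝ × ℝ}
    (hle : ∀ v, (I v).1 ≤ (I v).2)
    (hI : ∀ u v : V, u ≠ v → ¬ Set.Icc (I v).1 (I v).2 ⊂ Set.Icc (I u).1 (I u).2)
    {u v : V} (h : (I u).1 ≤ (I v).1) : (I u).2 ≤ (I v).2 := by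
  by_contra! hlt
  refine hI u v (by rintro rfl; exact hlt.false) ⟨Set.Icc_subset_Icc h hlt.le, fun hsub => ?_⟩
  exact hlt.not_ge (hsub (Set.right_mem_Icc.2 (hle u))).2

theorem Icc_inter_Icc_nonempty_iff_of_le {α : Type*} [LinearOrder α] {a b c d : α} (hcd : c ≤ d)
    (hac : a ≤ c) : (Set.Icc a b ∩ Set.Icc c d).Nonempty ↔ c ≤ b := by
  rw [Set.Icc_inter_Icc, Set.nonempty_Icc, max_eq_right hac, le_min_iff, and_iff_left hcd]

/-- A finite simple graph admits a unit interval representation iff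
it admits a proper interval representation. -/
theorem unit_iff_proper {V : Type*} [Fintype V] (G : SimpleGraph V) :
    (∃ I : V → ℝ × ℝ, G.IsIntervalRep I ∧ ∀ v, (I v).2 = (I v).1 + 1) ↔
    (∃ I : V → ℝ × ℝ, G.IsIntervalRep I ∧ ∀ u v : V, u ≠ v →
      ¬ Set.Icc (I v).1 (I v).2 ⊂ Set.Icc (I u).1 (I u).2) := by
  constructor
  · rintro ⟨I, hI, hunit⟩
    refine ⟨I, hI, fun u v _ hss => hss.2 ?_⟩
    obtain ⟨h₁, h₂⟩ := (Set.Icc_subset_Icc_iff (hI.1 v)).1 hss.1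
    exact Set.Icc_subset_Icc (by linarith [hunit u, hunit v]) (by linarith [hunit u, hunit v])
  · rintro ⟨I, ⟨hle, hadj⟩, hI⟩
    have hmono {u v : V} : (I u).1 ≤ (I v).1 → (I u).2 ≤ (I v).2 :=
      right_le_right_of_not_Icc_ssubset hle hI
    obtain ⟨R, hR⟩ : ∃ R : ℝ → ℝ, ∀ v, R (I v).1 = (I v).2 :=
      ⟨Function.extend (fun v => (I v).1) (fun v => (I v).2) id,
        Function.FactorsThrough.extend_apply
          (fun _ _ h => le_antisymm (hmono (le_of_eq h)) (hmono (ge_of_eq h))) _⟩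
    classical
    obtain ⟨x, hx⟩ := exists_embedding_real_of_monotoneOn R
      (Finset.univ.image fun v => (I v).1) (by
        simp only [Finset.coe_image, Finset.coe_univ, Set.image_univ]
        rintro _ ⟨u, rfl⟩ _ ⟨v, rfl⟩ h
        simpa only [hR] using hmono h)
    have key (u v : V) (h : (I u).1 < (I v).1) :=
      hx _ (Finset.mem_image_of_mem _ (Finset.mem_univ u)) _
        (Finset.mem_image_of_mem _ (Finset.mem_univ v)) h
    simp only [hR] at key
    refine ⟨fun v => (x (I v).1, x (I v).1 + 1), ⟨fun v => by simp, fun u v huv => ?_⟩,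
      fun v => rfl⟩
    rw [← hadj u v huv]
    wlog h : (I u).1 ≤ (I v).1 generalizing u v
    · rw [Set.inter_comm, this v u huv.symm (le_of_not_ge h), Set.inter_comm]
    rw [Icc_inter_Icc_nonempty_iff_of_le (hle v) h]
    rcases h.eq_or_lt with h | h
    · simp [← h, hle u]
    · obtain ⟨h₁, h₂, h₃⟩ := key u v h
      rw [Icc_inter_Icc_nonempty_iff_of_le (by simp) h₁.le]
      exact ⟨fun hc => not_lt.1 fun hlt => (h₃ hlt).not_ge hc, fun hc => (h₂ hc).le⟩
end

section
/- A finite simple graph G admits a proper interval representation if and only if G has a fine enumeration, i.e. a linear order σ of V(G) such that for every vertex u the closed neighborhood N_G[u] is consecutive with respect to σ. -/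
theorem SimpleGraph.IsIntervalRep.adj_or_eq_iff {V : Type*} {G : SimpleGraph V}
    {I : V → ℝ × ℝ} (hI : G.IsIntervalRep I) (u v : V) :
    (G.Adj u v ∨ u = v) ↔ (I u).1 ≤ (I v).2 ∧ (I v).1 ≤ (I u).2 := by
  by_cases huv : u = v
  · subst huv
    simp [hI.1 u]
  · rw [← hI.2 u v huv, Set.Icc_inter_Icc, Set.nonempty_Icc]
    simp [huv, hI.1 u, hI.1 v, and_comm]

/-- A finite linear order, given as a relation, is realized by a bounded ranking. -/
theorem exists_rank_of_linear_rel {V : Type*} [Fintype V] {le : V → V → Prop}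
    (refl : ∀ v, le v v) (trans : ∀ u v w, le u v → le v w → le u w)
    (antisymm : ∀ u v, le u v → le v u → u = v) (total : ∀ u v, le u v ∨ le v u) :
    ∃ p : V → ℕ, (∀ v, p v ≤ Fintype.card V) ∧ p.Injective ∧ ∀ u v, le u v ↔ p u ≤ p v := by
  classical
  have hle : ∀ u v, le u v ↔ (Finset.univ.filter (le · u)).card ≤
      (Finset.univ.filter (le · v)).card := by
    intro u v
    refine ⟨fun h => Finset.card_le_card fun w hw => ?_, fun h => ?_⟩
    · simp only [Finset.mem_filter, Finset.mem_univ, true_and] at hw ⊢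
      exact trans w u v hw h
    · by_contra huv
      have hvu := (total u v).resolve_left huv
      refine absurd h (not_le.mpr (Finset.card_lt_card ⟨fun w hw => ?_, fun hs => ?_⟩))
      · simp only [Finset.mem_filter, Finset.mem_univ, true_and] at hw ⊢
        exact trans w v u hw hvu
      · exact huv (by simpa using hs (by simpa using refl u))
  exact ⟨fun v => (Finset.univ.filter (le · v)).card, fun v => Finset.card_le_univ _,
    fun u v h => antisymm u v ((hle u v).2 h.le) ((hle v u).2 h.ge), hle⟩

/-- In a proper representation, the order of left endpoints is inherited by right endpoints. -/
theorem SimpleGraph.IsIntervalRep.right_le_of_left_le {V : Type*} {G : SimpleGraph V}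
    {I : V → ℝ × ℝ} (hI : G.IsIntervalRep I)
    (hproper : ∀ u v : V, u ≠ v → ¬ Set.Icc (I v).1 (I v).2 ⊂ Set.Icc (I u).1 (I u).2)
    {u v : V} (huv : (I u).1 < (I v).1 ∨ (I u).1 = (I v).1) : (I u).2 ≤ (I v).2 := by
  by_contra! h
  have hne : u ≠ v := by rintro rfl; exact lt_irrefl _ h
  refine hproper u v hne ⟨Set.Icc_subset_Icc (huv.elim le_of_lt le_of_eq) h.le, fun hs => ?_⟩
  exact absurd (hs (Set.right_mem_Icc.2 (hI.1 u))).2 (not_le.mpr h)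

/-- A ranking of the vertices in which closed neighborhoods are consecutive yields a proper
interval representation: `u` is assigned the interval from its rank to the largest rank in its
closed neighborhood, lengthened slightly in proportion to its rank. -/
theorem SimpleGraph.exists_proper_intervalRep_of_rank {V : Type*} [Fintype V]
    (G : SimpleGraph V) {p : V → ℕ} {n : ℕ} (hpn : ∀ v, p v ≤ n) (hp : p.Injective)
    (hcons : ∀ u a b c : V, p a ≤ p b → p b ≤ p c →
      (G.Adj u a ∨ u = a) → (G.Adj u c ∨ u = c) → (G.Adj u b ∨ u = b)) :
    ∃ I : V → ℝ × ℝ, G.IsIntervalRep I ∧ ∀ u v : V, u ≠ v →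
      ¬ Set.Icc (I v).1 (I v).2 ⊂ Set.Icc (I u).1 (I u).2 := by
  classical
  have hR : ∀ u, ∃ w, (G.Adj u w ∨ u = w) ∧ ∀ x, (G.Adj u x ∨ u = x) → p x ≤ p w := by
    intro u
    obtain ⟨w, hw, hmax⟩ := (Finset.univ.filter fun w => G.Adj u w ∨ u = w).exists_max_image p
      ⟨u, by simp⟩
    exact ⟨w, by simpa using hw, fun x hx => hmax x (by simpa using hx)⟩
  choose R hRadj hRmax using hR
  have hself : ∀ u, p u ≤ p (R u) := fun u => hRmax u u (Or.inr rfl)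
  have hmono : ∀ u v, p u ≤ p v → p (R u) ≤ p (R v) := by
    intro u v huv
    rcases le_total (p (R u)) (p v) with h | h
    · exact h.trans (hself v)
    · refine hRmax v _ ?_
      have hadj := hcons (R u) u v (R u) huv h ((hRadj u).imp SimpleGraph.Adj.symm Eq.symm) (Or.inr rfl)
      exact hadj.imp SimpleGraph.Adj.symm Eq.symm
  have hpos : (0 : ℝ) < n + 1 := by positivity
  have hshift : ∀ u, (0 : ℝ) ≤ p u / (n + 1) := fun u => by positivity
  have hshift_lt : ∀ u, (p u / (n + 1) : ℝ) < 1 := fun u => by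
    rw [div_lt_one hpos]
    exact_mod_cast Nat.lt_succ_of_le (hpn u)
  let I : V → ℝ × ℝ := fun u => (p u, p (R u) + p u / (n + 1))
  have hle : ∀ u, (I u).1 ≤ (I u).2 := fun u => by
    have h : (p u : ℝ) ≤ p (R u) := by exact_mod_cast hself u
    exact h.trans (le_add_of_nonneg_right (hshift u))
  have hadj : ∀ u v, p u < p v → ((I v).1 ≤ (I u).2 ↔ G.Adj u v) := by
    intro u v huv
    constructor
    · intro h
      have hlt : (p v : ℝ) < p (R u) + 1 := h.trans_lt (by simpa [I] using hshift_lt u)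
      have hvR : p v ≤ p (R u) := Nat.lt_succ_iff.1 (by exact_mod_cast hlt)
      exact (hcons u u v (R u) huv.le hvR (Or.inr rfl) (hRadj u)).resolve_right
        fun h => huv.ne (congrArg p h)
    · intro h
      have hvR : (p v : ℝ) ≤ p (R u) := by exact_mod_cast hRmax u v (Or.inl h)
      exact hvR.trans (le_add_of_nonneg_right (hshift u))
  have hinter : ∀ u v, p u < p v →
      ((Set.Icc (I u).1 (I u).2 ∩ Set.Icc (I v).1 (I v).2).Nonempty ↔ G.Adj u v) := by
    intro u v huv
    have hl : (I u).1 ≤ (I v).1 := by simpa [I] using huv.le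
    rw [← hadj u v huv, Set.Icc_inter_Icc, Set.nonempty_Icc]
    simp [hle v, hl]
  refine ⟨I, ⟨hle, fun u v huv => ?_⟩, fun u v huv hss => ?_⟩
  · rcases (hp.ne huv).lt_or_gt with h | h
    · exact hinter u v h
    · rw [Set.inter_comm, G.adj_comm]
      exact hinter v u h
  · obtain ⟨hl, hr⟩ := (Set.Icc_subset_Icc_iff (hle v)).1 hss.1
    have huv' : p u < p v := lt_of_le_of_ne (Nat.cast_le.1 hl) (hp.ne huv)
    refine absurd hr (not_le.mpr (add_lt_add_of_le_of_lt ?_ ?_))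
    · exact_mod_cast hmono u v huv'.le
    · exact div_lt_div_of_pos_right (by exact_mod_cast huv') hpos

/-- A finite simple graph admits a proper interval representation
iff it has a fine enumeration: a linear order of its vertices in which every closed
neighborhood is consecutive. -/
theorem proper_iff_fineEnumeration {V : Type*} [Fintype V] (G : SimpleGraph V) :
    (∃ I : V → ℝ × ℝ, G.IsIntervalRep I ∧ ∀ u v : V, u ≠ v →
      ¬ Set.Icc (I v).1 (I v).2 ⊂ Set.Icc (I u).1 (I u).2) ↔
    ∃ le : V → V → Prop, (∀ v, le v v) ∧ (∀ u v w, le u v → le v w → le u w) ∧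
      (∀ u v, le u v → le v u → u = v) ∧ (∀ u v, le u v ∨ le v u) ∧
      ∀ u a b c : V, le a b → le b c →
        (G.Adj u a ∨ u = a) → (G.Adj u c ∨ u = c) → (G.Adj u b ∨ u = b) := by
  constructor
  · rintro ⟨I, hI, hproper⟩
    let e := Fintype.equivFin V
    let key : V → ℝ ×ₗ Fin (Fintype.card V) := fun v => toLex ((I v).1, e v)
    have hkey : ∀ {u v}, key u ≤ key v → (I u).1 ≤ (I v).1 ∧ (I u).2 ≤ (I v).2 := by
      intro u v h
      have hl : (I u).1 < (I v).1 ∨ (I u).1 = (I v).1 :=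
        (Prod.Lex.toLex_le_toLex.1 h).imp_right And.left
      exact ⟨hl.elim le_of_lt le_of_eq, hI.right_le_of_left_le hproper hl⟩
    refine ⟨fun u v => key u ≤ key v, fun v => le_rfl, fun u v w => le_trans, fun u v h h' => ?_,
      fun u v => le_total _ _, fun u a b c hab hbc ha hc => ?_⟩
    · exact e.injective (congrArg (fun x => (ofLex x).2) (le_antisymm h h'))
    · rw [hI.adj_or_eq_iff] at ha hc ⊢
      exact ⟨ha.1.trans (hkey hab).2, (hkey hbc).1.trans hc.2⟩
  · rintro ⟨le, refl, trans, antisymm, total, hcons⟩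
    obtain ⟨p, hpn, hp, hle⟩ := exists_rank_of_linear_rel refl trans antisymm total
    simp only [hle] at hcons
    exact G.exists_proper_intervalRep_of_rank hpn hp hcons
end
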